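/- arXiv:2209.00646 — 4 statements merged into one kernel-verified Lean document; each statement's English description precedes it below -/
import Mathlib

section
/- Let ℋ be a finite-dimensional complex Hilbert space, A a positive semidefinite operator on ℋ, P an orthogonal projection on ℋ, and z ∈ (0,∞). Then Tr((PAP)^z) ≤ Tr(A^z). Moreover, if the support projection A⁰ of A does not satisfy A⁰ ≤ P, then the inequality is strict: Tr((PAP)^z) < Tr(A^z). -/
open Filter Set Topology
open scoped ComplexOrder

noncomputable section

namespace QRenyi

attribute [local instance] Classical.propDecidable

variable {ι : Type*} [Fintype ι] [DecidableEq ι]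

/-- Apply a real function to the eigenvalues of a Hermitian matrix (functional calculus);
junk value `0` for non-Hermitian matrices. -/
noncomputable def hermApply (f : ℝ → ℝ) (A : Matrix ι ι ℂ) : Matrix ι ι ℂ :=
  if hA : A.IsHermitian then hA.cfc f else 0

/-- Real power of a positive semidefinite matrix, taken on its support:
`t ↦ t ^ x` is applied to the nonzero eigenvalues and `0` is mapped to `0`.
In particular `matPow A 0` is the support projection of `A`. -/
noncomputable def matPow (A : Matrix ι ι ℂ) (x : ℝ) : Matrix ι ι ℂ :=
  hermApply (fun t => if t = 0 then 0 else t ^ x) A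

/-- Logarithm of a positive semidefinite matrix taken on its support
(`Real.log 0 = 0` in Mathlib, matching the convention `log̃ 0 = 0`). -/
noncomputable def matLog (A : Matrix ι ι ℂ) : Matrix ι ι ℂ :=
  hermApply Real.log A

/-- `supp ρ ≤ supp σ`, expressed (for PSD matrices) as inclusion of kernels. -/
def suppLE (ρ σ : Matrix ι ι ℂ) : Prop :=
  ∀ v : ι → ℂ, σ.mulVec v = 0 → ρ.mulVec v = 0

/-- The Loewner (positive semidefinite) order. -/
def loewnerLE (A B : Matrix ι ι ℂ) : Prop := (B - A).PosSemidef

/-- Real part of the trace. -/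
noncomputable def reTrace (A : Matrix ι ι ℂ) : ℝ := A.trace.re

/-- The trace quantity `Tr ((σ^{(1-α)/(2z)} ρ^{α/z} σ^{(1-α)/(2z)})^z)` (a real number). -/
noncomputable def Qaz (α z : ℝ) (ρ σ : Matrix ι ι ℂ) : ℝ :=
  reTrace (matPow (matPow σ ((1 - α) / (2 * z)) * matPow ρ (α / z) *
    matPow σ ((1 - α) / (2 * z))) z)

/-- The Rényi `(α,z)`-divergence (for `α ≠ 1`), with values in `EReal = ℝ ∪ {±∞}`.
It equals `(α-1)⁻¹ (log Q_{α,z}(ρ‖σ) - log Tr ρ)`; it is `+∞` when `α > 1` and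
`supp ρ ≰ supp σ`, and also `+∞` when `α < 1` and `Q_{α,z}(ρ‖σ) = 0`
(i.e. `(α-1)⁻¹ log 0 = +∞`). -/
noncomputable def Daz (α z : ℝ) (ρ σ : Matrix ι ι ℂ) : EReal :=
  if (suppLE ρ σ ∨ α < 1) ∧ Qaz α z ρ σ ≠ 0 then
    (((α - 1)⁻¹ * (Real.log (Qaz α z ρ σ) - Real.log (reTrace ρ)) : ℝ) : EReal)
  else ⊤

/-- The (normalized) Umegaki relative entropy. -/
noncomputable def DUm (ρ σ : Matrix ι ι ℂ) : EReal :=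
  if suppLE ρ σ then
    (((reTrace ρ)⁻¹ * reTrace (ρ * (matLog ρ - matLog σ)) : ℝ) : EReal)
  else ⊤

/-- The Rényi `(α,z)`-divergence, with `D_{1,z} := D^Um`. -/
noncomputable def Dfull (α z : ℝ) (ρ σ : Matrix ι ι ℂ) : EReal :=
  if α = 1 then DUm ρ σ else Daz α z ρ σ

/-- The max-relative entropy `D_max(ρ‖σ) = log inf {λ > 0 : ρ ≤ λ σ}`. -/
noncomputable def Dmax (ρ σ : Matrix ι ι ℂ) : EReal :=
  if ∃ c : ℝ, 0 < c ∧ loewnerLE ρ (c • σ) then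
    ((Real.log (sInf {c : ℝ | 0 < c ∧ loewnerLE ρ (c • σ)}) : ℝ) : EReal)
  else ⊤

/-- The classical quantity `Q_α^cl(ρ‖σ) = ∑_x ρ(x)^α σ(x)^{1-α}` (with `0^t = 0` for `t ≠ 0`). -/
noncomputable def Qcl {X : Type*} [Fintype X] (α : ℝ) (ρ σ : X → ℝ) : ℝ :=
  ∑ x, ρ x ^ α * σ x ^ (1 - α)

/-- Absolute continuity `ρ ≪ σ` for functions on a finite set. -/
def acl {X : Type*} (ρ σ : X → ℝ) : Prop := ∀ x, σ x = 0 → ρ x = 0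

/-- The classical Rényi `α`-divergence, with values in `EReal`; for `α = 1` it is the
(normalized) Kullback-Leibler divergence. -/
noncomputable def Dcl {X : Type*} [Fintype X] (α : ℝ) (ρ σ : X → ℝ) : EReal :=
  if α = 1 then
    (if acl ρ σ then
      ((((∑ x, ρ x)⁻¹ * ∑ x, ρ x * (Real.log (ρ x) - Real.log (σ x))) : ℝ) : EReal)
     else ⊤)
  else if (acl ρ σ ∨ α < 1) ∧ Qcl α ρ σ ≠ 0 then
    ((((α - 1)⁻¹ * (Real.log (Qcl α ρ σ) - Real.log (∑ x, ρ x))) : ℝ) : EReal)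
  else ⊤

/-- The measured Rényi `α`-divergence: supremum over all finite-outcome POVMs. -/
noncomputable def Dmeas (α : ℝ) (ρ σ : Matrix ι ι ℂ) : EReal :=
  ⨆ (k : ℕ) (M : Fin k → Matrix ι ι ℂ)
    (_ : (∀ i, (M i).PosSemidef) ∧ ∑ i, M i = 1),
    Dcl α (fun i => reTrace (M i * ρ)) (fun i => reTrace (M i * σ))

/-- A `κ`-function: a continuous nonnegative function on `[0,∞)` with
`limsup_{x→0⁺} f(x) x^{-κ} < ∞`. -/
def IsKappaFunction (κ : ℝ) (f : ℝ → ℝ) : Prop :=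
  ContinuousOn f (Set.Ici 0) ∧ (∀ x ∈ Set.Ici (0 : ℝ), 0 ≤ f x) ∧
    ∃ M : ℝ, ∀ᶠ x in 𝓝[>] (0 : ℝ), f x ≤ M * x ^ κ

/-- A strict `κ`-function: a `κ`-function with `liminf_{x→0⁺} f(x) x^{-κ} > 0`. -/
def IsStrictKappaFunction (κ : ℝ) (f : ℝ → ℝ) : Prop :=
  IsKappaFunction κ f ∧ ∃ c : ℝ, 0 < c ∧ ∀ᶠ x in 𝓝[>] (0 : ℝ), c * x ^ κ ≤ f x

/-- Nonzero PSD matrix predicate. -/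
def PSDne (A : Matrix ι ι ℂ) : Prop := A.PosSemidef ∧ A ≠ 0


section EigenvalueMonotonicity

variable {𝕜 E : Type*} [RCLike 𝕜] [NormedAddCommGroup E] [InnerProductSpace 𝕜 E]
  {S T : E →ₗ[𝕜] E} {m : ℕ}

lemma re_inner_apply_eq_sum_eigenvalues [FiniteDimensional 𝕜 E] (hT : T.IsSymmetric)
    (hm : Module.finrank 𝕜 E = m) (v : E) :
    RCLike.re (inner 𝕜 (T v) v) =
      ∑ j, hT.eigenvalues hm j * ‖(hT.eigenvectorBasis hm).repr v j‖ ^ 2 := by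
  rw [← (hT.eigenvectorBasis hm).repr.inner_map_map, PiLp.inner_apply, map_sum]
  refine Finset.sum_congr rfl fun j _ => ?_
  rw [hT.eigenvectorBasis_apply_self_apply, ← smul_eq_mul,
    inner_smul_left, RCLike.conj_ofReal, RCLike.re_ofReal_mul, inner_self_eq_norm_sq]

lemma finrank_span_orthonormalBasis_image (b : OrthonormalBasis (Fin m) 𝕜 E)
    (s : Finset (Fin m)) :
    Module.finrank 𝕜 (Submodule.span 𝕜 (b '' (s : Set (Fin m)))) = s.card := by
  have h := b.orthonormal.linearIndependent
  rw [Set.image_eq_range]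
  simpa [Function.comp_def] using finrank_span_eq_card (h.comp (Subtype.val : ↥(s : Set (Fin m)) → Fin m)
    Subtype.val_injective)

lemma repr_eq_zero_of_mem_span_image (b : OrthonormalBasis (Fin m) 𝕜 E) {s : Set (Fin m)}
    {v : E} (hv : v ∈ Submodule.span 𝕜 (b '' s)) {j : Fin m} (hj : j ∉ s) :
    b.repr v j = 0 := by
  rw [← b.coe_toBasis, Module.Basis.mem_span_image] at hv
  have : j ∉ (b.toBasis.repr v).support := fun h => hj (hv h)
  simpa using this

/-- **Weyl's monotonicity theorem**: the decreasingly ordered eigenvalues of symmetric maps are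
monotone in the Loewner order. -/
theorem eigenvalues_le_eigenvalues_of_re_inner_le [FiniteDimensional 𝕜 E]
    (hS : S.IsSymmetric) (hT : T.IsSymmetric) (hm : Module.finrank 𝕜 E = m)
    (h : ∀ v, RCLike.re (inner 𝕜 (S v) v) ≤ RCLike.re (inner 𝕜 (T v) v)) (i : Fin m) :
    hS.eigenvalues hm i ≤ hT.eigenvalues hm i := by
  by_contra! hlt
  set b := hS.eigenvectorBasis hm
  set c := hT.eigenvectorBasis hm
  have hnd : ¬ Disjoint (Submodule.span 𝕜 (b '' (Finset.Iic i : Set (Fin m))))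
      (Submodule.span 𝕜 (c '' (Finset.Ici i : Set (Fin m)))) := fun hd => by
    have := Submodule.finrank_add_finrank_le_of_disjoint hd
    rw [finrank_span_orthonormalBasis_image, finrank_span_orthonormalBasis_image, hm,
      Fin.card_Iic, Fin.card_Ici] at this
    omega
  rw [Submodule.disjoint_def] at hnd
  push Not at hnd
  obtain ⟨v, hvb, hvc, hv⟩ := hnd
  have hlow : hS.eigenvalues hm i * ‖v‖ ^ 2 ≤ RCLike.re (inner 𝕜 (S v) v) := by
    rw [re_inner_apply_eq_sum_eigenvalues hS hm, ← b.repr.norm_map v, EuclideanSpace.norm_sq_eq,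
      Finset.mul_sum]
    refine Finset.sum_le_sum fun j _ => ?_
    by_cases hj : j ≤ i
    · exact mul_le_mul_of_nonneg_right (hS.eigenvalues_antitone hm hj) (by positivity)
    · simp [b, repr_eq_zero_of_mem_span_image _ hvb (j := j) (by simpa using hj)]
  have hupp : RCLike.re (inner 𝕜 (T v) v) ≤ hT.eigenvalues hm i * ‖v‖ ^ 2 := by
    rw [re_inner_apply_eq_sum_eigenvalues hT hm, ← c.repr.norm_map v, EuclideanSpace.norm_sq_eq,
      Finset.mul_sum]
    refine Finset.sum_le_sum fun j _ => ?_
    by_cases hj : i ≤ j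
    · exact mul_le_mul_of_nonneg_right (hT.eigenvalues_antitone hm hj) (by positivity)
    · simp [c, repr_eq_zero_of_mem_span_image _ hvc (j := j) (by simpa using hj)]
  have := mul_lt_mul_of_pos_right hlt (show 0 < ‖v‖ ^ 2 by positivity)
  linarith [h v]

end EigenvalueMonotonicity

lemma eigenvalues_le_of_posSemidef_sub {A B : Matrix ι ι ℂ} (hB : B.IsHermitian)
    (hA : A.IsHermitian) (h : (A - B).PosSemidef) (i : ι) :
    hB.eigenvalues i ≤ hA.eigenvalues i := by
  refine eigenvalues_le_eigenvalues_of_re_inner_le _ _ _ (fun v => ?_) _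
  have := h.re_dotProduct_nonneg v.ofLp
  rw [Matrix.sub_mulVec, dotProduct_sub, map_sub, sub_nonneg] at this
  rw [← inner_conj_symm, ← inner_conj_symm (Matrix.toEuclideanLin A v), RCLike.conj_re,
    RCLike.conj_re]
  simpa [EuclideanSpace.inner_eq_star_dotProduct, dotProduct_comm] using this

lemma reTrace_hermApply (f : ℝ → ℝ) {A : Matrix ι ι ℂ} (hA : A.IsHermitian) :
    reTrace (hermApply f A) = ∑ i, f (hA.eigenvalues i) := by
  rw [reTrace, hermApply, dif_pos hA, Matrix.IsHermitian.cfc,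
    Unitary.conjStarAlgAut_apply, Matrix.trace_mul_comm, ← mul_assoc]
  simp [Matrix.trace_diagonal]

lemma reTrace_matPow {A : Matrix ι ι ℂ} (hA : A.IsHermitian) {z : ℝ} (hz : 0 < z) :
    reTrace (matPow A z) = ∑ i, hA.eigenvalues i ^ z := by
  rw [matPow, reTrace_hermApply _ hA]
  refine Finset.sum_congr rfl fun i _ => ?_
  split_ifs with h
  · rw [h, Real.zero_rpow hz.ne']
  · rfl

lemma reTrace_matPow_congr {A B : Matrix ι ι ℂ} (hA : A.IsHermitian) (hB : B.IsHermitian)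
    (h : A.charpoly = B.charpoly) {z : ℝ} (hz : 0 < z) :
    reTrace (matPow A z) = reTrace (matPow B z) := by
  rw [reTrace_matPow hA hz, reTrace_matPow hB hz, (hA.eigenvalues_eq_eigenvalues_iff hB).2 h]

lemma reTrace_matPow_le {A B : Matrix ι ι ℂ} (hB : B.PosSemidef) (hA : A.PosSemidef)
    (h : (A - B).PosSemidef) {z : ℝ} (hz : 0 < z) :
    reTrace (matPow B z) ≤ reTrace (matPow A z) := by
  rw [reTrace_matPow hB.1 hz, reTrace_matPow hA.1 hz]
  exact Finset.sum_le_sum fun i _ => Real.rpow_le_rpow (hB.eigenvalues_nonneg i)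
    (eigenvalues_le_of_posSemidef_sub hB.1 hA.1 h i) hz.le

lemma reTrace_matPow_lt {A B : Matrix ι ι ℂ} (hB : B.PosSemidef) (hA : A.PosSemidef)
    (h : (A - B).PosSemidef) (hne : A - B ≠ 0) {z : ℝ} (hz : 0 < z) :
    reTrace (matPow B z) < reTrace (matPow A z) := by
  have hle := eigenvalues_le_of_posSemidef_sub hB.1 hA.1 h
  obtain ⟨i, hi⟩ : ∃ i, hB.1.eigenvalues i < hA.1.eigenvalues i := by
    by_contra! hge
    refine hne (h.trace_eq_zero_iff.1 ?_)
    rw [Matrix.trace_sub, hA.1.trace_eq_sum_eigenvalues, hB.1.trace_eq_sum_eigenvalues,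
      funext fun i => (hle i).antisymm (hge i), sub_self]
  rw [reTrace_matPow hB.1 hz, reTrace_matPow hA.1 hz]
  exact Finset.sum_lt_sum
    (fun i _ => Real.rpow_le_rpow (hB.eigenvalues_nonneg i) (hle i) hz.le)
    ⟨i, Finset.mem_univ i, Real.rpow_lt_rpow (hB.eigenvalues_nonneg i) hi hz⟩

lemma matPow_zero_eq_cfc {A : Matrix ι ι ℂ} (hA : A.IsHermitian) :
    matPow A 0 = cfc (fun t : ℝ => if t = 0 then (0 : ℝ) else 1) A := by
  rw [matPow, hermApply, dif_pos hA, hA.cfc_eq]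
  simp

lemma matPow_zero_loewnerLE {A P : Matrix ι ι ℂ} (hA : A.IsHermitian) (hP : P.IsHermitian)
    (hP2 : P * P = P) (hPA : P * A = A) : loewnerLE (matPow A 0) P := by
  have hc (f : ℝ → ℝ) : ContinuousOn f (spectrum ℝ A) :=
    A.finite_real_spectrum.continuousOn f
  set S := matPow A 0 with hS
  rw [matPow_zero_eq_cfc hA] at hS
  have hSH : S.IsHermitian := by rw [hS]; exact cfc_predicate _ A
  have hSS : S * S = S := by
    rw [hS, ← cfc_mul _ _ A (hc _) (hc _)]
    congr! 2 with t
    simp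
  have hAS : S = A * cfc (fun t : ℝ => t⁻¹) A := by
    have := cfc_mul (fun t : ℝ => t) (fun t : ℝ => t⁻¹) A (hc _) (hc _)
    rw [cfc_id' ℝ A hA.isSelfAdjoint] at this
    rw [← this, hS]
    congr! 2 with t
    split_ifs with h <;> simp [h]
  have hPS : P * S = S := by rw [hAS, ← mul_assoc, hPA]
  have hSP : S * P = S := by
    have := congrArg Matrix.conjTranspose hPS
    rwa [Matrix.conjTranspose_mul, hP.eq, hSH.eq] at this
  have hsq : P - S = (P - S).conjTranspose * (P - S) := by
    rw [Matrix.conjTranspose_sub, hP.eq, hSH.eq, mul_sub, sub_mul, sub_mul, hP2, hPS, hSP, hSS]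
    abel
  rw [loewnerLE, hsq]
  exact Matrix.posSemidef_conjTranspose_mul_self _

open scoped MatrixOrder Matrix.Norms.L2Operator in
lemma exists_eq_conjTranspose_mul_self {A : Matrix ι ι ℂ} (hA : A.PosSemidef) :
    ∃ C : Matrix ι ι ℂ, A = C.conjTranspose * C :=
  CStarAlgebra.nonneg_iff_eq_star_mul_self.mp hA.nonneg

/-- For a PSD operator `A`, a projection `P` and `z > 0`,
`Tr((PAP)^z) ≤ Tr(A^z)`, with strict inequality if the support projection of `A`
is not below `P`. -/
theorem trace_rpow_projection_compression
    {n : ℕ} (A P : Matrix (Fin n) (Fin n) ℂ)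
    (hA : A.PosSemidef) (hP : P.IsHermitian) (hP2 : P * P = P)
    (z : ℝ) (hz : 0 < z) :
    reTrace (matPow (P * A * P) z) ≤ reTrace (matPow A z) ∧
      (¬ loewnerLE (matPow A 0) P →
        reTrace (matPow (P * A * P) z) < reTrace (matPow A z)) := by
  obtain ⟨C, rfl⟩ := exists_eq_conjTranspose_mul_self hA
  set A' := C * C.conjTranspose with hA'
  set B := C * P * C.conjTranspose with hB
  have hA'p : A'.PosSemidef := Matrix.posSemidef_self_mul_conjTranspose C
  have hPp : P.PosSemidef := by
    simpa [hP.eq, hP2] using Matrix.posSemidef_conjTranspose_mul_self P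
  have hBp : B.PosSemidef := hPp.mul_mul_conjTranspose_same C
  have hPAP : (P * (C.conjTranspose * C) * P).IsHermitian := by
    simpa [hP.eq] using Matrix.isHermitian_mul_mul_conjTranspose P hA.1
  have hchar : (P * (C.conjTranspose * C) * P).charpoly = B.charpoly := by
    calc (P * (C.conjTranspose * C) * P).charpoly
        = ((P * C.conjTranspose) * (C * P)).charpoly := by simp only [mul_assoc]
      _ = (C * (P * P) * C.conjTranspose).charpoly := by
        rw [Matrix.charpoly_mul_comm]; simp only [mul_assoc]
      _ = B.charpoly := by rw [hP2]
  have hsub : A' - B = ((1 - P) * C.conjTranspose).conjTranspose * ((1 - P) * C.conjTranspose) := by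
    have h1 : (1 - P) * (1 - P) = 1 - P := by simp [mul_sub, sub_mul, hP2]
    have h2 : (1 - P).conjTranspose = 1 - P := by simp [hP.eq]
    rw [Matrix.conjTranspose_mul, Matrix.conjTranspose_conjTranspose, h2, mul_assoc,
      ← mul_assoc (1 - P), h1, hA', hB]
    noncomm_ring
  have hsubp : (A' - B).PosSemidef := by
    rw [hsub]; exact Matrix.posSemidef_conjTranspose_mul_self _
  rw [reTrace_matPow_congr hPAP hBp.1 hchar hz,
    reTrace_matPow_congr hA.1 hA'p.1 (Matrix.charpoly_mul_comm _ _) hz]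
  refine ⟨reTrace_matPow_le hBp hA'p hsubp hz, fun hnle =>
    reTrace_matPow_lt hBp hA'p hsubp (fun h0 => hnle ?_) hz⟩
  rw [hsub, Matrix.conjTranspose_mul_self_eq_zero, sub_mul, one_mul, sub_eq_zero] at h0
  exact matPow_zero_loewnerLE hA.1 hP hP2 (by rw [← mul_assoc, ← h0])

end QRenyi

end
end

section
/- For any finite-dimensional complex Hilbert space ℋ, the map (α, z, ρ, σ) ↦ (σ^{(1−α)/(2z)} ρ^{α/z} σ^{(1−α)/(2z)})^z is continuous on (0,1) × (0,∞) × {nonzero PSD operators on ℋ} × {nonzero PSD operators on ℋ} (with values in the operators on ℋ), and consequently the map (α, z, ρ, σ) ↦ D_{α,z}(ρ‖σ) is continuous on the same set. -/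
open Filter Set Topology
open scoped ComplexOrder

noncomputable section

namespace QRenyi

attribute [local instance] Classical.propDecidable

variable {ι : Type*} [Fintype ι] [DecidableEq ι]

/-- On positive semidefinite matrices `matPow` with positive exponent is the continuous functional
calculus of `t ↦ t ^ x`. -/
lemma matPow_eq_cfc {A : Matrix ι ι ℂ} (hA : A.PosSemidef) {x : ℝ} (hx : 0 < x) :
    matPow A x = cfc (fun t : ℝ => t ^ x) A := by
  have h : (fun t : ℝ => if t = 0 then 0 else t ^ x) = fun t => t ^ x := by
    funext t
    split_ifs with ht
    · rw [ht, Real.zero_rpow hx.ne']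
    · rfl
  rw [matPow, hermApply, dif_pos hA.isHermitian, h, hA.isHermitian.cfc_eq]

lemma spectrum_real_subset_Ici {A : Matrix ι ι ℂ} (hA : A.PosSemidef) :
    spectrum ℝ A ⊆ Ici 0 := by
  rw [hA.isHermitian.spectrum_real_eq_range_eigenvalues]
  rintro _ ⟨i, rfl⟩
  exact hA.eigenvalues_nonneg i

open scoped MatrixOrder in
lemma posSemidef_matPow {A : Matrix ι ι ℂ} (hA : A.PosSemidef) {x : ℝ} (hx : 0 < x) :
    (matPow A x).PosSemidef := by
  rw [matPow_eq_cfc hA hx, ← Matrix.nonneg_iff_posSemidef]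
  exact cfc_nonneg fun t ht => Real.rpow_nonneg (spectrum_real_subset_Ici hA ht) x

lemma posSemidef_mul_mul {κ : Type*} [Fintype κ] {A B : Matrix κ κ ℂ}
    (hA : A.PosSemidef) (hB : B.PosSemidef) :
    (B * A * B).PosSemidef := by
  simpa only [hB.isHermitian.eq] using hA.mul_mul_conjTranspose_same B

/-- The functions `t ↦ t ^ x` depend continuously on `x > 0`, uniformly on compact subsets of
`[0, ∞)`. -/
lemma continuousOn_ofFun_rpow {s : Set ℝ} (hs : IsCompact s) :
    ContinuousOn (fun x : ℝ => UniformOnFun.ofFun {s} (fun t : ℝ => t ^ x)) (Ioi 0) := by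
  intro x₀ hx₀
  refine UniformOnFun.tendsto_iff_tendstoUniformlyOn.2 ?_
  intro k hk
  rw [mem_singleton_iff.1 hk]
  intro u hu
  have hc : ContinuousOn (Function.uncurry fun x t : ℝ => t ^ x) (Ioi 0 ×ˢ s) :=
    ContinuousOn.rpow continuousOn_snd continuousOn_fst fun p hp => Or.inr hp.1
  obtain ⟨v, hv, h⟩ := hs.mem_uniformity_of_prod hc hx₀ (UniformSpace.symm hu)
  filter_upwards [hv] with x hx t ht using h x hx t ht

open scoped Matrix.Norms.L2Operator in
/-- The power map is jointly continuous in the exponent and the matrix, for positive exponents and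
positive semidefinite matrices. -/
lemma continuousOn_matPow :
    ContinuousOn (fun p : ℝ × Matrix ι ι ℂ => matPow p.2 p.1)
      {p | 0 < p.1 ∧ p.2.PosSemidef} := by
  rintro ⟨x₀, A₀⟩ ⟨hx₀, hA₀⟩
  set c : ℝ := (‖A₀‖ + 1) * ‖(1 : Matrix ι ι ℂ)‖
  set s : Set ℝ := Metric.closedBall 0 c ∩ Ici 0
  have hs : IsCompact s := (isCompact_closedBall 0 c).inter_right isClosed_Ici
  have hspec : ∀ A : Matrix ι ι ℂ, A.PosSemidef → ‖A‖ ≤ ‖A₀‖ + 1 → spectrum ℝ A ⊆ s :=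
    fun A hA hn => subset_inter ((spectrum.subset_closedBall_norm_mul A).trans
      (Metric.closedBall_subset_closedBall (mul_le_mul_of_nonneg_right hn (norm_nonneg _))))
      (spectrum_real_subset_Ici hA)
  have hcfc : ContinuousOn (fun p : ℝ × Matrix ι ι ℂ => cfc (fun t : ℝ => t ^ p.1) p.2)
      (Ioi 0 ×ˢ {A | IsSelfAdjoint A ∧ spectrum ℝ A ⊆ s}) := by
    refine (continuousOn_cfc_setProd (A := Matrix ι ι ℂ) (𝕜 := ℝ) hs).comp
      (f := fun p : ℝ × Matrix ι ι ℂ =>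
        (UniformOnFun.ofFun {s} (fun t : ℝ => t ^ p.1), p.2))
      (((continuousOn_ofFun_rpow hs).comp continuousOn_fst fun p hp => hp.1).prodMk
        continuousOn_snd) ?_
    rintro ⟨x, A⟩ ⟨hx, hA⟩
    exact ⟨continuousOn_id.rpow_const fun t _ => Or.inr (le_of_lt hx), hA⟩
  have hev : ∀ᶠ p : ℝ × Matrix ι ι ℂ in 𝓝 (x₀, A₀), ‖p.2‖ ≤ ‖A₀‖ + 1 :=
    (continuous_snd.norm.tendsto (x₀, A₀)).eventually (eventually_le_nhds (lt_add_one _))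
  have hmem : Ioi 0 ×ˢ {A | IsSelfAdjoint A ∧ spectrum ℝ A ⊆ s} ∈
      𝓝[{p : ℝ × Matrix ι ι ℂ | 0 < p.1 ∧ p.2.PosSemidef}] (x₀, A₀) := by
    filter_upwards [self_mem_nhdsWithin, mem_nhdsWithin_of_mem_nhds hev] with p hp hn
    exact ⟨hp.1, hp.2.isHermitian, hspec _ hp.2 hn⟩
  have h := (hcfc (x₀, A₀) ⟨hx₀, hA₀.isHermitian,
    hspec A₀ hA₀ (by linarith)⟩).mono_of_mem_nhdsWithin hmem
  exact h.congr (fun p hp => matPow_eq_cfc hp.2 hp.1) (matPow_eq_cfc hA₀ hx₀)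

lemma reTrace_pos {κ : Type*} [Fintype κ] {A : Matrix κ κ ℂ} (hA : PSDne A) : 0 < reTrace A := by
  have h0 : 0 < A.trace :=
    hA.1.trace_nonneg.lt_of_ne' (mt hA.1.trace_eq_zero_iff.1 hA.2)
  exact (Complex.lt_def.1 h0).1

lemma continuous_reTrace {κ : Type*} [Fintype κ] : Continuous (reTrace : Matrix κ κ ℂ → ℝ) :=
  Complex.continuous_re.comp (Continuous.matrix_trace continuous_id)

/-- The set of `(α, z, ρ, σ)` with `α ∈ (0, 1)`, `z > 0` and `ρ`, `σ` nonzero positive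
semidefinite. -/
def alphaLtOneDomain (ι : Type*) [Fintype ι] : Set (ℝ × ℝ × Matrix ι ι ℂ × Matrix ι ι ℂ) :=
  {x | x.1 ∈ Ioo (0 : ℝ) 1 ∧ 0 < x.2.1 ∧ PSDne x.2.2.1 ∧ PSDne x.2.2.2}

lemma continuousOn_matPow_sandwich :
    ContinuousOn
      (fun x : ℝ × ℝ × Matrix ι ι ℂ × Matrix ι ι ℂ =>
        matPow (matPow x.2.2.2 ((1 - x.1) / (2 * x.2.1)) * matPow x.2.2.1 (x.1 / x.2.1) *
          matPow x.2.2.2 ((1 - x.1) / (2 * x.2.1))) x.2.1)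
      (alphaLtOneDomain ι) := by
  have hpos : ∀ x ∈ alphaLtOneDomain ι, 0 < (1 - x.1) / (2 * x.2.1) ∧ 0 < x.1 / x.2.1 :=
    fun x hx => ⟨div_pos (sub_pos.2 hx.1.2) (mul_pos two_pos hx.2.1), div_pos hx.1.1 hx.2.1⟩
  have hσ : ContinuousOn (fun x : ℝ × ℝ × Matrix ι ι ℂ × Matrix ι ι ℂ =>
      matPow x.2.2.2 ((1 - x.1) / (2 * x.2.1))) (alphaLtOneDomain ι) := by
    refine continuousOn_matPow.comp
      (f := fun x : ℝ × ℝ × Matrix ι ι ℂ × Matrix ι ι ℂ =>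
        ((1 - x.1) / (2 * x.2.1), x.2.2.2)) (ContinuousOn.prodMk ?_ (by fun_prop))
      fun x hx => ⟨(hpos x hx).1, hx.2.2.2.1⟩
    exact ContinuousOn.div (by fun_prop) (by fun_prop)
      fun x hx => (mul_pos two_pos hx.2.1).ne'
  have hρ : ContinuousOn (fun x : ℝ × ℝ × Matrix ι ι ℂ × Matrix ι ι ℂ =>
      matPow x.2.2.1 (x.1 / x.2.1)) (alphaLtOneDomain ι) := by
    refine continuousOn_matPow.comp
      (f := fun x : ℝ × ℝ × Matrix ι ι ℂ × Matrix ι ι ℂ => (x.1 / x.2.1, x.2.2.1))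
      (ContinuousOn.prodMk ?_ (by fun_prop)) fun x hx => ⟨(hpos x hx).2, hx.2.2.1.1⟩
    exact ContinuousOn.div (by fun_prop) (by fun_prop) fun x hx => hx.2.1.ne'
  refine continuousOn_matPow.comp
    (f := fun x : ℝ × ℝ × Matrix ι ι ℂ × Matrix ι ι ℂ =>
      (x.2.1, matPow x.2.2.2 ((1 - x.1) / (2 * x.2.1)) * matPow x.2.2.1 (x.1 / x.2.1) *
        matPow x.2.2.2 ((1 - x.1) / (2 * x.2.1))))
    (ContinuousOn.prodMk (by fun_prop) ((hσ.mul hρ).mul hσ)) fun x hx => ⟨hx.2.1, ?_⟩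
  exact posSemidef_mul_mul (posSemidef_matPow hx.2.2.1.1 (hpos x hx).2)
    (posSemidef_matPow hx.2.2.2.1 (hpos x hx).1)

lemma continuousOn_Qaz :
    ContinuousOn (fun x : ℝ × ℝ × Matrix ι ι ℂ × Matrix ι ι ℂ => Qaz x.1 x.2.1 x.2.2.1 x.2.2.2)
      (alphaLtOneDomain ι) :=
  continuous_reTrace.comp_continuousOn continuousOn_matPow_sandwich

lemma continuousOn_Daz :
    ContinuousOn (fun x : ℝ × ℝ × Matrix ι ι ℂ × Matrix ι ι ℂ => Daz x.1 x.2.1 x.2.2.1 x.2.2.2)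
      (alphaLtOneDomain ι) := by
  intro x₀ hx₀
  have hQ := continuousOn_Qaz x₀ hx₀
  have hinv : ContinuousWithinAt (fun x : ℝ × ℝ × Matrix ι ι ℂ × Matrix ι ι ℂ => (x.1 - 1)⁻¹)
      (alphaLtOneDomain ι) x₀ :=
    ContinuousWithinAt.inv₀ (by fun_prop) (sub_neg.2 hx₀.1.2).ne
  have hlogtr : ContinuousWithinAt
      (fun x : ℝ × ℝ × Matrix ι ι ℂ × Matrix ι ι ℂ => Real.log (reTrace x.2.2.1))
      (alphaLtOneDomain ι) x₀ :=
    ContinuousWithinAt.log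
      (continuous_reTrace.comp (by fun_prop : Continuous
        fun x : ℝ × ℝ × Matrix ι ι ℂ × Matrix ι ι ℂ => x.2.2.1)).continuousWithinAt
      (reTrace_pos hx₀.2.2.1).ne'
  have hDaz : ∀ x ∈ alphaLtOneDomain ι, Qaz x.1 x.2.1 x.2.2.1 x.2.2.2 ≠ 0 →
      Daz x.1 x.2.1 x.2.2.1 x.2.2.2 = (((x.1 - 1)⁻¹ *
        (Real.log (Qaz x.1 x.2.1 x.2.2.1 x.2.2.2) - Real.log (reTrace x.2.2.1)) : ℝ) : EReal) :=
    fun x hx hne => if_pos ⟨Or.inr hx.1.2, hne⟩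
  by_cases h0 : Qaz x₀.1 x₀.2.1 x₀.2.2.1 x₀.2.2.2 = 0
  · have htop : Daz x₀.1 x₀.2.1 x₀.2.2.1 x₀.2.2.2 = ⊤ := if_neg fun h => h.2 h0
    have hQ0 : Tendsto (fun x : ℝ × ℝ × Matrix ι ι ℂ × Matrix ι ι ℂ =>
        Qaz x.1 x.2.1 x.2.2.1 x.2.2.2) (𝓝[alphaLtOneDomain ι] x₀) (𝓝 0) := h0 ▸ hQ
    have hlog : Tendsto (fun x : ℝ × ℝ × Matrix ι ι ℂ × Matrix ι ι ℂ =>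
        Real.log (Qaz x.1 x.2.1 x.2.2.1 x.2.2.2))
        (𝓝[alphaLtOneDomain ι] x₀ ⊓ 𝓟 {x | Qaz x.1 x.2.1 x.2.2.1 x.2.2.2 ≠ 0}) atBot :=
      Real.tendsto_log_nhdsNE_zero.comp
        (tendsto_inf.2 ⟨hQ0.mono_left inf_le_left,
          tendsto_principal.2 (mem_inf_of_right (mem_principal_self _))⟩)
    have hreal := (hinv.tendsto.mono_left inf_le_left).neg_mul_atBot
      (inv_neg''.2 (sub_neg.2 hx₀.1.2))
      (hlog.atBot_add (hlogtr.tendsto.mono_left inf_le_left).neg)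
    simp only [← sub_eq_add_neg] at hreal
    rw [ContinuousWithinAt, htop, EReal.tendsto_nhds_top_iff_real]
    intro M
    filter_upwards [self_mem_nhdsWithin,
      eventually_inf_principal.1 (hreal.eventually (eventually_gt_atTop M))] with x hx hM
    by_cases hne : Qaz x.1 x.2.1 x.2.2.1 x.2.2.2 = 0
    · rw [Daz, if_neg fun h => h.2 hne]
      exact EReal.coe_lt_top M
    · rw [hDaz x hx hne]
      exact EReal.coe_lt_coe_iff.2 (hM hne)
  · have hreal := hinv.mul ((hQ.log h0).sub hlogtr)
    refine (continuous_coe_real_ereal.continuousAt.comp_continuousWithinAt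
      hreal).congr_of_eventuallyEq ?_ (hDaz x₀ hx₀ h0)
    filter_upwards [self_mem_nhdsWithin, hQ.eventually_ne h0] with x hx hne using hDaz x hx hne

/-- Joint continuity of
`(α, z, ρ, σ) ↦ (σ^{(1-α)/(2z)} ρ^{α/z} σ^{(1-α)/(2z)})^z` and of `D_{α,z}` on
`(0,1) × (0,∞) × {nonzero PSD} × {nonzero PSD}`. -/
theorem renyi_az_continuousOn_alpha_lt_one {n : ℕ} :
    ContinuousOn
      (fun x : ℝ × ℝ × Matrix (Fin n) (Fin n) ℂ × Matrix (Fin n) (Fin n) ℂ =>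
        matPow (matPow x.2.2.2 ((1 - x.1) / (2 * x.2.1)) * matPow x.2.2.1 (x.1 / x.2.1) *
          matPow x.2.2.2 ((1 - x.1) / (2 * x.2.1))) x.2.1)
      {x : ℝ × ℝ × Matrix (Fin n) (Fin n) ℂ × Matrix (Fin n) (Fin n) ℂ |
        x.1 ∈ Set.Ioo (0 : ℝ) 1 ∧ 0 < x.2.1 ∧ PSDne x.2.2.1 ∧ PSDne x.2.2.2} ∧
    ContinuousOn
      (fun x : ℝ × ℝ × Matrix (Fin n) (Fin n) ℂ × Matrix (Fin n) (Fin n) ℂ =>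
        Daz x.1 x.2.1 x.2.2.1 x.2.2.2)
      {x : ℝ × ℝ × Matrix (Fin n) (Fin n) ℂ × Matrix (Fin n) (Fin n) ℂ |
        x.1 ∈ Set.Ioo (0 : ℝ) 1 ∧ 0 < x.2.1 ∧ PSDne x.2.2.1 ∧ PSDne x.2.2.2} := by
  exact ⟨continuousOn_matPow_sandwich, continuousOn_Daz⟩

end QRenyi

end
end

section
/- Let X be a finite set, κ > 0, and f a κ-function. Then: (a) the map (α, ρ, σ) ↦ D_α^cl(ρ‖σ) is continuous on (0,1) × {nonzero nonnegative functions on X}²; (b) the map (α, ρ, σ) ↦ D_α^cl(ρ‖σ) is continuous on {α ∈ (1,∞) : (1−κ)α < 1} × {(ρ,σ) : ρ, σ nonzero nonnegative functions on X with ρ(x) ≤ f(σ(x)) for all x}; (c) for every fixed α ∈ (0,∞) with (1−κ)α < 1 (including α = 1), the map (ρ, σ) ↦ D_α^cl(ρ‖σ) is continuous on {(ρ,σ) : ρ, σ nonzero nonnegative functions on X with ρ(x) ≤ f(σ(x)) for all x}. -/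
open Filter Set Topology
open scoped ComplexOrder

noncomputable section

namespace QRenyi

attribute [local instance] Classical.propDecidable

variable {ι : Type*} [Fintype ι] [DecidableEq ι]

namespace IsKappaFunction

variable {κ : ℝ} {f : ℝ → ℝ}

theorem apply_zero_le (hκ : 0 < κ) (hf : IsKappaFunction κ f) : f 0 ≤ 0 := by
  obtain ⟨hc, -, M, hM⟩ := hf
  have h1 : Tendsto f (𝓝[>] 0) (𝓝 (f 0)) :=
    (hc 0 self_mem_Ici).mono_left (nhdsWithin_mono _ Ioi_subset_Ici_self)
  have h2 : Tendsto (fun x : ℝ => M * x ^ κ) (𝓝[>] 0) (𝓝 (M * 0 ^ κ)) :=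
    ((Real.continuousAt_rpow_const 0 κ (Or.inr hκ.le)).tendsto.const_mul M).mono_left
      nhdsWithin_le_nhds
  rw [Real.zero_rpow hκ.ne', mul_zero] at h2
  exact le_of_tendsto_of_tendsto h1 h2 hM

theorem exists_pos_bound (hκ : 0 < κ) (hf : IsKappaFunction κ f) :
    ∃ M : ℝ, 0 < M ∧ ∀ᶠ x in 𝓝[≥] (0 : ℝ), f x ≤ M * x ^ κ := by
  have h0 := hf.apply_zero_le hκ
  obtain ⟨-, -, M, hM⟩ := hf
  refine ⟨max M 1, by positivity, ?_⟩
  rw [← Ioi_insert, nhdsWithin_insert, eventually_sup, eventually_pure]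
  refine ⟨by simpa [Real.zero_rpow hκ.ne'] using h0, ?_⟩
  filter_upwards [hM, self_mem_nhdsWithin] with x hx hx0
  have : 0 ≤ x ^ κ := Real.rpow_nonneg (le_of_lt hx0) κ
  exact hx.trans (by gcongr; exact le_max_left _ _)

theorem acl_of_le {X : Type*} (hκ : 0 < κ) (hf : IsKappaFunction κ f) {ρ σ : X → ℝ}
    (hρ : ∀ x, 0 ≤ ρ x) (h : ∀ x, ρ x ≤ f (σ x)) : acl ρ σ := by
  intro x hx
  have h1 := h x
  rw [hx] at h1
  exact le_antisymm (h1.trans (hf.apply_zero_le hκ)) (hρ x)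

end IsKappaFunction

section ClassicalContinuity

variable {X : Type*} [Fintype X]

theorem sum_pos_of_nonneg_of_ne_zero {ρ : X → ℝ} (h : (∀ x, 0 ≤ ρ x) ∧ ρ ≠ 0) :
    0 < ∑ x, ρ x := by
  obtain ⟨x, hx⟩ := Function.ne_iff.1 h.2
  exact Finset.sum_pos' (fun i _ => h.1 i) ⟨x, Finset.mem_univ x, (h.1 x).lt_of_ne' hx⟩

theorem Qcl_nonneg {α : ℝ} {ρ σ : X → ℝ} (hρ : ∀ x, 0 ≤ ρ x) (hσ : ∀ x, 0 ≤ σ x) :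
    0 ≤ Qcl α ρ σ :=
  Finset.sum_nonneg fun x _ =>
    mul_nonneg (Real.rpow_nonneg (hρ x) _) (Real.rpow_nonneg (hσ x) _)

theorem Qcl_pos_of_acl {α : ℝ} {ρ σ : X → ℝ} (hρ : (∀ x, 0 ≤ ρ x) ∧ ρ ≠ 0)
    (hσ : ∀ x, 0 ≤ σ x) (h : acl ρ σ) : 0 < Qcl α ρ σ := by
  obtain ⟨x, hx⟩ := Function.ne_iff.1 hρ.2
  refine Finset.sum_pos' (fun i _ =>
    mul_nonneg (Real.rpow_nonneg (hρ.1 i) _) (Real.rpow_nonneg (hσ i) _))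
    ⟨x, Finset.mem_univ x, mul_pos (Real.rpow_pos_of_pos ((hρ.1 x).lt_of_ne' hx) _)
      (Real.rpow_pos_of_pos ((hσ x).lt_of_ne' fun h0 => hx (h x h0)) _)⟩

theorem continuousAt_Qcl_of_mem_Ioo {t : ℝ × (X → ℝ) × (X → ℝ)} (ht : t.1 ∈ Ioo (0 : ℝ) 1) :
    ContinuousAt (fun t : ℝ × (X → ℝ) × (X → ℝ) => Qcl t.1 t.2.1 t.2.2) t := by
  unfold Qcl
  refine tendsto_finsetSum _ fun x _ => ContinuousAt.mul ?_ ?_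
  · exact ContinuousAt.rpow (by fun_prop) (by fun_prop) (Or.inr ht.1)
  · exact ContinuousAt.rpow (by fun_prop) (by fun_prop) (Or.inr (sub_pos.2 ht.2))

theorem continuousOn_rpow_mul_rpow_of_le_kappa {T : Type*} [TopologicalSpace T] {κ : ℝ}
    (hκ : 0 < κ) {f : ℝ → ℝ} (hf : IsKappaFunction κ f) {α r s : T → ℝ} {S : Set T}
    (hα : ContinuousOn α S) (hr : ContinuousOn r S) (hs : ContinuousOn s S)
    (hα1 : ∀ t ∈ S, 1 < α t) (hακ : ∀ t ∈ S, (1 - κ) * α t < 1)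
    (hr0 : ∀ t ∈ S, 0 ≤ r t) (hs0 : ∀ t ∈ S, 0 ≤ s t) (hrs : ∀ t ∈ S, r t ≤ f (s t)) :
    ContinuousOn (fun t => r t ^ α t * s t ^ (1 - α t)) S := by
  intro t ht
  have hαt := hα1 t ht
  rcases eq_or_ne (s t) 0 with h0 | h0
  · obtain ⟨M, hM, hb⟩ := hf.exists_pos_bound hκ
    have hst : Tendsto s (𝓝[S] t) (𝓝[≥] 0) := by
      refine tendsto_nhdsWithin_iff.2 ⟨h0 ▸ hs t ht, ?_⟩
      filter_upwards [self_mem_nhdsWithin] with u hu using hs0 u hu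
    have hbound : ContinuousWithinAt
        (fun u => M ^ α u * s u ^ (κ * α u + (1 - α u))) S t := by
      have h1 := hα t ht
      refine ContinuousWithinAt.mul
        (ContinuousWithinAt.rpow continuousWithinAt_const h1 (Or.inl hM.ne'))
        (ContinuousWithinAt.rpow (hs t ht)
          ((h1.const_mul κ).add (continuousWithinAt_const.sub h1)) (Or.inr ?_))
      linarith [hακ t ht]
    have hlim := hbound.tendsto
    have he : κ * α t + (1 - α t) ≠ 0 := by linarith [hακ t ht]
    rw [h0, Real.zero_rpow he, mul_zero] at hlim
    change Tendsto _ _ (𝓝 (r t ^ α t * s t ^ (1 - α t)))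
    rw [h0, Real.zero_rpow (by linarith : 1 - α t ≠ 0), mul_zero]
    refine squeeze_zero' ?_ ?_ hlim
    · filter_upwards [self_mem_nhdsWithin] with u hu
      exact mul_nonneg (Real.rpow_nonneg (hr0 u hu) _) (Real.rpow_nonneg (hs0 u hu) _)
    · filter_upwards [self_mem_nhdsWithin, hst.eventually hb] with u hu hbu
      have hαu := hα1 u hu
      rcases (hs0 u hu).eq_or_lt' with hz | hpos
      · rw [hz, Real.zero_rpow (by linarith : 1 - α u ≠ 0), mul_zero]
        exact mul_nonneg (Real.rpow_nonneg hM.le _) (Real.rpow_nonneg le_rfl _)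
      · calc r u ^ α u * s u ^ (1 - α u)
            ≤ (M * s u ^ κ) ^ α u * s u ^ (1 - α u) := by
              gcongr
              · exact hr0 u hu
              · exact (hrs u hu).trans hbu
          _ = M ^ α u * s u ^ (κ * α u + (1 - α u)) := by
              rw [Real.mul_rpow hM.le (by positivity), ← Real.rpow_mul hpos.le, mul_assoc,
                ← Real.rpow_add hpos]
  · exact ContinuousWithinAt.mul
      (ContinuousWithinAt.rpow (hr t ht) (hα t ht) (Or.inr (by linarith)))
      (ContinuousWithinAt.rpow (hs t ht) (continuousWithinAt_const.sub (hα t ht)) (Or.inl h0))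

theorem continuousOn_mul_log_of_le_kappa {T : Type*} [TopologicalSpace T] {κ : ℝ}
    (hκ : 0 < κ) {f : ℝ → ℝ} (hf : IsKappaFunction κ f) {r s : T → ℝ} {S : Set T}
    (hr : ContinuousOn r S) (hs : ContinuousOn s S)
    (hr0 : ∀ t ∈ S, 0 ≤ r t) (hs0 : ∀ t ∈ S, 0 ≤ s t) (hrs : ∀ t ∈ S, r t ≤ f (s t)) :
    ContinuousOn (fun t => r t * Real.log (s t)) S := by
  intro t ht
  rcases eq_or_ne (s t) 0 with h0 | h0
  · obtain ⟨M, hM, hb⟩ := hf.exists_pos_bound hκ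
    have hst : Tendsto s (𝓝[S] t) (𝓝[≥] 0) := by
      refine tendsto_nhdsWithin_iff.2 ⟨h0 ▸ hs t ht, ?_⟩
      filter_upwards [self_mem_nhdsWithin] with u hu using hs0 u hu
    have hpow : ContinuousWithinAt (fun u => s u ^ κ) S t :=
      (hs t ht).rpow_const (Or.inr hκ.le)
    have hlim : Tendsto (fun u => M * κ⁻¹ * |s u ^ κ * Real.log (s u ^ κ)|) (𝓝[S] t) (𝓝 0) := by
      have := ((Real.continuous_mul_log.continuousAt.comp_continuousWithinAt
        hpow).abs.const_mul (M * κ⁻¹)).tendsto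
      simpa [h0, Real.zero_rpow hκ.ne'] using this
    change Tendsto _ _ (𝓝 (r t * Real.log (s t)))
    rw [h0, Real.log_zero, mul_zero]
    refine squeeze_zero_norm' ?_ hlim
    filter_upwards [self_mem_nhdsWithin, hst.eventually hb] with u hu hbu
    rcases (hs0 u hu).eq_or_lt' with hz | hpos
    · rw [hz, Real.log_zero, mul_zero, norm_zero]
      positivity
    · have hp : 0 < s u ^ κ := Real.rpow_pos_of_pos hpos κ
      rw [Real.norm_eq_abs, abs_mul, abs_mul, abs_of_nonneg (hr0 u hu), abs_of_pos hp,
        Real.log_rpow hpos, abs_mul, abs_of_pos hκ]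
      calc r u * |Real.log (s u)| ≤ (M * s u ^ κ) * |Real.log (s u)| := by
            gcongr
            exact (hrs u hu).trans hbu
        _ = M * κ⁻¹ * (s u ^ κ * (κ * |Real.log (s u)|)) := by
            field_simp
  · exact (hr t ht).mul ((hs t ht).log h0)

theorem tendsto_coe_log_div_or_top {T : Type*} {l : Filter T} {α Q S : T → ℝ} {S₀ : ℝ}
    (hα : ∀ᶠ t in l, α t ∈ Ioo (0 : ℝ) 1) (hQ0 : ∀ᶠ t in l, 0 ≤ Q t)
    (hQ : Tendsto Q l (𝓝 0)) (hS : Tendsto S l (𝓝 S₀)) (hS0 : 0 < S₀) :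
    Tendsto (fun t => if Q t ≠ 0 then
      (((α t - 1)⁻¹ * (Real.log (Q t) - Real.log (S t)) : ℝ) : EReal) else ⊤) l (𝓝 ⊤) := by
  rw [EReal.tendsto_nhds_top_iff_real]
  intro c
  have hlogS := hS.log hS0.ne'
  filter_upwards [hα, hQ0, hQ.eventually_lt_const (Real.exp_pos (Real.log S₀ - 1 - |c|)),
    hlogS.eventually_const_lt (sub_one_lt (Real.log S₀))] with t hαt hQt hQlt hSt
  split_ifs with h
  · rw [EReal.coe_lt_coe_iff]
    have hlogQ : Real.log (Q t) < Real.log S₀ - 1 - |c| :=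
      (Real.log_lt_iff_lt_exp (hQt.lt_of_ne' h)).2 hQlt
    have hinv : 1 ≤ (1 - α t)⁻¹ :=
      (one_le_inv₀ (sub_pos.2 hαt.2)).2 (by linarith [hαt.1])
    have hd : |c| < Real.log (S t) - Real.log (Q t) := by linarith
    calc c ≤ |c| := le_abs_self c
      _ < Real.log (S t) - Real.log (Q t) := hd
      _ ≤ (1 - α t)⁻¹ * (Real.log (S t) - Real.log (Q t)) :=
        le_mul_of_one_le_left ((abs_nonneg c).trans hd.le) hinv
      _ = (α t - 1)⁻¹ * (Real.log (Q t) - Real.log (S t)) := by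
        rw [← neg_sub (α t) 1, inv_neg]
        ring
  · exact EReal.coe_lt_top c

theorem continuousWithinAt_coe_log_div {T : Type*} [TopologicalSpace T] {α Q S : T → ℝ}
    {A : Set T} {t : T} (hα : ContinuousWithinAt α A t) (hQ : ContinuousWithinAt Q A t)
    (hS : ContinuousWithinAt S A t) (hα1 : α t ≠ 1) (hQ0 : Q t ≠ 0) (hS0 : S t ≠ 0) :
    ContinuousWithinAt (fun t =>
      (((α t - 1)⁻¹ * (Real.log (Q t) - Real.log (S t)) : ℝ) : EReal)) A t :=
  continuous_coe_real_ereal.continuousAt.comp_continuousWithinAt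
    (((hα.sub continuousWithinAt_const).inv₀ (sub_ne_zero.2 hα1)).mul
      ((hQ.log hQ0).sub (hS.log hS0)))

theorem Dcl_of_lt_one {α : ℝ} (hα : α < 1) (ρ σ : X → ℝ) :
    Dcl α ρ σ = if Qcl α ρ σ ≠ 0 then
      (((α - 1)⁻¹ * (Real.log (Qcl α ρ σ) - Real.log (∑ x, ρ x)) : ℝ) : EReal) else ⊤ := by
  simp [Dcl, hα, hα.ne]

theorem Dcl_of_acl {α : ℝ} (hα : α ≠ 1) {ρ σ : X → ℝ} (hρ : (∀ x, 0 ≤ ρ x) ∧ ρ ≠ 0)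
    (hσ : ∀ x, 0 ≤ σ x) (h : acl ρ σ) :
    Dcl α ρ σ = (((α - 1)⁻¹ * (Real.log (Qcl α ρ σ) - Real.log (∑ x, ρ x)) : ℝ) : EReal) := by
  rw [Dcl, if_neg hα, if_pos ⟨Or.inl h, (Qcl_pos_of_acl hρ hσ h).ne'⟩]

theorem continuousOn_Dcl_Ioo :
    ContinuousOn (fun t : ℝ × (X → ℝ) × (X → ℝ) => Dcl t.1 t.2.1 t.2.2)
      {t : ℝ × (X → ℝ) × (X → ℝ) | t.1 ∈ Set.Ioo (0 : ℝ) 1 ∧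
        ((∀ x, 0 ≤ t.2.1 x) ∧ t.2.1 ≠ 0) ∧ ((∀ x, 0 ≤ t.2.2 x) ∧ t.2.2 ≠ 0)} := by
  refine ContinuousOn.congr (f := fun t : ℝ × (X → ℝ) × (X → ℝ) =>
    if Qcl t.1 t.2.1 t.2.2 ≠ 0 then (((t.1 - 1)⁻¹ *
      (Real.log (Qcl t.1 t.2.1 t.2.2) - Real.log (∑ x, t.2.1 x)) : ℝ) : EReal) else ⊤) ?_
    fun t ht => Dcl_of_lt_one ht.1.2 _ _
  rintro t ⟨hα, hρ, hσ⟩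
  have hQ := (continuousAt_Qcl_of_mem_Ioo hα).continuousWithinAt
    (s := {t : ℝ × (X → ℝ) × (X → ℝ) | t.1 ∈ Set.Ioo (0 : ℝ) 1 ∧
      ((∀ x, 0 ≤ t.2.1 x) ∧ t.2.1 ≠ 0) ∧ ((∀ x, 0 ≤ t.2.2 x) ∧ t.2.2 ≠ 0)})
  have hS : Continuous fun t : ℝ × (X → ℝ) × (X → ℝ) => ∑ x, t.2.1 x := by fun_prop
  have hS0 := sum_pos_of_nonneg_of_ne_zero hρ
  by_cases h : Qcl t.1 t.2.1 t.2.2 = 0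
  · rw [ContinuousWithinAt, if_neg (not_not.2 h)]
    refine tendsto_coe_log_div_or_top ?_ ?_ (h ▸ hQ.tendsto) hS.continuousWithinAt.tendsto hS0
    · filter_upwards [self_mem_nhdsWithin] with u hu using hu.1
    · filter_upwards [self_mem_nhdsWithin] with u hu using Qcl_nonneg hu.2.1.1 hu.2.2.1
  · refine (continuousWithinAt_coe_log_div continuousWithinAt_fst hQ hS.continuousWithinAt
      hα.2.ne h hS0.ne').congr_of_eventuallyEq ?_ (if_pos h)
    filter_upwards [hQ.eventually_ne h] with u hu using if_pos hu

theorem continuousOn_Dcl_of_one_lt {κ : ℝ} (hκ : 0 < κ) {f : ℝ → ℝ}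
    (hf : IsKappaFunction κ f) :
    ContinuousOn (fun t : ℝ × (X → ℝ) × (X → ℝ) => Dcl t.1 t.2.1 t.2.2)
      {t : ℝ × (X → ℝ) × (X → ℝ) | 1 < t.1 ∧ (1 - κ) * t.1 < 1 ∧
        ((∀ x, 0 ≤ t.2.1 x) ∧ t.2.1 ≠ 0) ∧ ((∀ x, 0 ≤ t.2.2 x) ∧ t.2.2 ≠ 0) ∧
        (∀ x, t.2.1 x ≤ f (t.2.2 x))} := by
  refine ContinuousOn.congr (f := fun t : ℝ × (X → ℝ) × (X → ℝ) => (((t.1 - 1)⁻¹ *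
      (Real.log (Qcl t.1 t.2.1 t.2.2) - Real.log (∑ x, t.2.1 x)) : ℝ) : EReal)) ?_ ?_
  · intro t ht
    obtain ⟨hα, -, hρ, hσ, hle⟩ := id ht
    have hS : Continuous fun t : ℝ × (X → ℝ) × (X → ℝ) => ∑ x, t.2.1 x := by fun_prop
    refine continuousWithinAt_coe_log_div continuousWithinAt_fst ?_ hS.continuousWithinAt
      hα.ne' (Qcl_pos_of_acl hρ hσ.1 (hf.acl_of_le hκ hρ.1 hle)).ne'
      (sum_pos_of_nonneg_of_ne_zero hρ).ne'
    unfold Qcl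
    refine tendsto_finsetSum _ fun x _ => ?_
    exact continuousOn_rpow_mul_rpow_of_le_kappa hκ hf (by fun_prop) (by fun_prop) (by fun_prop)
      (fun u hu => hu.1) (fun u hu => hu.2.1) (fun u hu => hu.2.2.1.1 x)
      (fun u hu => hu.2.2.2.1.1 x) (fun u hu => hu.2.2.2.2 x) t ht
  · rintro t ⟨hα, -, hρ, hσ, hle⟩
    exact Dcl_of_acl hα.ne' hρ hσ.1 (hf.acl_of_le hκ hρ.1 hle)

theorem continuousOn_Dcl_one {κ : ℝ} (hκ : 0 < κ) {f : ℝ → ℝ} (hf : IsKappaFunction κ f) :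
    ContinuousOn (fun p : (X → ℝ) × (X → ℝ) => Dcl 1 p.1 p.2)
      {p : (X → ℝ) × (X → ℝ) | ((∀ x, 0 ≤ p.1 x) ∧ p.1 ≠ 0) ∧
        ((∀ x, 0 ≤ p.2 x) ∧ p.2 ≠ 0) ∧ (∀ x, p.1 x ≤ f (p.2 x))} := by
  refine ContinuousOn.congr (f := fun p : (X → ℝ) × (X → ℝ) =>
    (((∑ x, p.1 x)⁻¹ * ∑ x, p.1 x * (Real.log (p.1 x) - Real.log (p.2 x)) : ℝ) : EReal)) ?_ ?_
  · refine continuous_coe_real_ereal.comp_continuousOn (ContinuousOn.mul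
      (ContinuousOn.inv₀ (by fun_prop) fun p hp => (sum_pos_of_nonneg_of_ne_zero hp.1).ne')
      (continuousOn_finsetSum _ fun x _ => ?_))
    simp_rw [mul_sub]
    refine ContinuousOn.sub ?_ ?_
    · exact (Real.continuous_mul_log.comp
        (by fun_prop : Continuous fun p : (X → ℝ) × (X → ℝ) => p.1 x)).continuousOn
    · exact continuousOn_mul_log_of_le_kappa hκ hf (by fun_prop) (by fun_prop)
        (fun p hp => hp.1.1 x) (fun p hp => hp.2.1.1 x) (fun p hp => hp.2.2 x)
  · rintro p ⟨hρ, -, hle⟩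
    simp only [Dcl, if_true]
    rw [if_pos (hf.acl_of_le hκ hρ.1 hle)]

end ClassicalContinuity

/-- Continuity properties of the classical Rényi divergences:
(a) joint continuity on `(0,1) × {nonzero nonnegative}²`;
(b) joint continuity on `{α ∈ (1,∞) : (1-κ)α < 1} × {(ρ,σ) : ρ ≤ f ∘ σ}`;
(c) for fixed `α ∈ (0,∞)` with `(1-κ)α < 1` (including `α = 1`), continuity
on `{(ρ,σ) : ρ ≤ f ∘ σ}`. -/
theorem classical_renyi_continuity {X : Type*} [Fintype X] (κ : ℝ) (hκ : 0 < κ)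
    (f : ℝ → ℝ) (hf : IsKappaFunction κ f) :
    ContinuousOn (fun t : ℝ × (X → ℝ) × (X → ℝ) => Dcl t.1 t.2.1 t.2.2)
      {t : ℝ × (X → ℝ) × (X → ℝ) | t.1 ∈ Set.Ioo (0 : ℝ) 1 ∧
        ((∀ x, 0 ≤ t.2.1 x) ∧ t.2.1 ≠ 0) ∧ ((∀ x, 0 ≤ t.2.2 x) ∧ t.2.2 ≠ 0)} ∧
    ContinuousOn (fun t : ℝ × (X → ℝ) × (X → ℝ) => Dcl t.1 t.2.1 t.2.2)
      {t : ℝ × (X → ℝ) × (X → ℝ) | 1 < t.1 ∧ (1 - κ) * t.1 < 1 ∧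
        ((∀ x, 0 ≤ t.2.1 x) ∧ t.2.1 ≠ 0) ∧ ((∀ x, 0 ≤ t.2.2 x) ∧ t.2.2 ≠ 0) ∧
        (∀ x, t.2.1 x ≤ f (t.2.2 x))} ∧
    ∀ α : ℝ, 0 < α → (1 - κ) * α < 1 →
      ContinuousOn (fun p : (X → ℝ) × (X → ℝ) => Dcl α p.1 p.2)
        {p : (X → ℝ) × (X → ℝ) | ((∀ x, 0 ≤ p.1 x) ∧ p.1 ≠ 0) ∧
          ((∀ x, 0 ≤ p.2 x) ∧ p.2 ≠ 0) ∧ (∀ x, p.1 x ≤ f (p.2 x))} := by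
  refine ⟨continuousOn_Dcl_Ioo, continuousOn_Dcl_of_one_lt hκ hf, fun α hα hακ => ?_⟩
  have hpair : Continuous fun p : (X → ℝ) × (X → ℝ) => (α, p) := by fun_prop
  rcases lt_trichotomy α 1 with h | rfl | h
  · exact continuousOn_Dcl_Ioo.comp hpair.continuousOn fun p hp => ⟨⟨hα, h⟩, hp.1, hp.2.1⟩
  · exact continuousOn_Dcl_one hκ hf
  · exact (continuousOn_Dcl_of_one_lt hκ hf).comp hpair.continuousOn
      fun p hp => ⟨h, hακ, hp.1, hp.2.1, hp.2.2⟩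

end QRenyi

end
end

section
/- Let X be a finite set with |X| ≥ 2, κ > 0, and α ∈ (0,∞) with (1−κ)α ≥ 1. Let f be a strict κ-function such that x ≤ f(x) for all x ∈ (1−ε, 1) for some ε ∈ (0,1). Then the map (p, q) ↦ D_α^cl(p‖q) is not continuous on the set {(p,q) : p, q probability density functions on X with p(x) ≤ f(q(x)) for all x ∈ X}. -/
open Filter Set Topology
open scoped ComplexOrder

noncomputable section

namespace QRenyi

attribute [local instance] Classical.propDecidable

variable {ι : Type*} [Fintype ι] [DecidableEq ι]

/-- The function on `X` with value `s` at `a`, `1 - s` at `b`, and `0` elsewhere. -/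
def twoPoint {X : Type*} (a b : X) (s : ℝ) : X → ℝ :=
  fun x => if x = a then s else if x = b then 1 - s else 0

section TwoPoint

variable {X : Type*} {a b : X}

lemma twoPoint_left (s : ℝ) : twoPoint a b s a = s := by simp [twoPoint]

lemma twoPoint_right (hab : a ≠ b) (s : ℝ) : twoPoint a b s b = 1 - s := by
  simp [twoPoint, hab.symm]

lemma twoPoint_of_ne {x : X} (hxa : x ≠ a) (hxb : x ≠ b) (s : ℝ) : twoPoint a b s x = 0 := by
  simp [twoPoint, hxa, hxb]

lemma twoPoint_nonneg {s : ℝ} (h0 : 0 ≤ s) (h1 : s ≤ 1) (x : X) : 0 ≤ twoPoint a b s x := by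
  unfold twoPoint
  split_ifs <;> linarith

lemma continuous_twoPoint : Continuous (twoPoint a b) := by
  refine continuous_pi fun x => ?_
  unfold twoPoint
  split_ifs <;> fun_prop

lemma acl_twoPoint (hab : a ≠ b) {s t : ℝ} (ht0 : t = 0 → s = 0) (ht1 : t < 1) :
    acl (twoPoint a b s) (twoPoint a b t) := by
  intro x hx
  by_cases hxa : x = a
  · subst hxa
    rw [twoPoint_left] at hx ⊢
    exact ht0 hx
  by_cases hxb : x = b
  · subst hxb
    rw [twoPoint_right hab] at hx
    linarith
  · exact twoPoint_of_ne hxa hxb s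

variable [Fintype X]

lemma sum_twoPoint (hab : a ≠ b) (s : ℝ) : ∑ x, twoPoint a b s x = 1 := by
  rw [Fintype.sum_eq_add a b hab fun x hx => twoPoint_of_ne hx.1 hx.2 s,
    twoPoint_left, twoPoint_right hab]
  ring

lemma Qcl_twoPoint (hab : a ≠ b) {α : ℝ} (hα : α ≠ 0) (s t : ℝ) :
    Qcl α (twoPoint a b s) (twoPoint a b t)
      = s ^ α * t ^ (1 - α) + (1 - s) ^ α * (1 - t) ^ (1 - α) := by
  unfold Qcl
  rw [Fintype.sum_eq_add a b hab fun x hx => by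
    rw [twoPoint_of_ne hx.1 hx.2 s, Real.zero_rpow hα, zero_mul]]
  simp only [twoPoint_left, twoPoint_right hab]

/-- The divergence of two-point densities, the second one nonzero at `b`. -/
lemma Dcl_twoPoint (hab : a ≠ b) {α : ℝ} (hα : 1 < α) {s t : ℝ} (ht0 : t = 0 → s = 0)
    (ht1 : t < 1)
    (hQ : 0 < s ^ α * t ^ (1 - α) + (1 - s) ^ α * (1 - t) ^ (1 - α)) :
    Dcl α (twoPoint a b s) (twoPoint a b t) =
      (((α - 1)⁻¹ *
        Real.log (s ^ α * t ^ (1 - α) + (1 - s) ^ α * (1 - t) ^ (1 - α)) : ℝ) : EReal) := by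
  have hα0 : α ≠ 0 := by linarith
  unfold Dcl
  rw [if_neg hα.ne', Qcl_twoPoint hab hα0, if_pos ⟨Or.inl (acl_twoPoint hab ht0 ht1), hQ.ne'⟩,
    sum_twoPoint hab, Real.log_one, sub_zero]

end TwoPoint

/-- If `(1-κ)α ≥ 1` and `f` is a strict `κ`-function with `x ≤ f x`
near `1` from the left, then `D_α^cl` is not continuous on the set of pairs of
probability densities with `p ≤ f ∘ q`. -/
theorem classical_renyi_not_continuousOn {X : Type*} [Fintype X]
    (hX : 2 ≤ Fintype.card X) (κ α : ℝ) (hκ : 0 < κ) (hα : 0 < α)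
    (h1 : 1 ≤ (1 - κ) * α) (f : ℝ → ℝ) (hf : IsStrictKappaFunction κ f)
    (ε : ℝ) (hε : ε ∈ Set.Ioo (0 : ℝ) 1) (hfx : ∀ x ∈ Set.Ioo (1 - ε) 1, x ≤ f x) :
    ¬ ContinuousOn (fun p : (X → ℝ) × (X → ℝ) => Dcl α p.1 p.2)
      {p : (X → ℝ) × (X → ℝ) | (∀ x, 0 ≤ p.1 x) ∧ (∑ x, p.1 x) = 1 ∧
        (∀ x, 0 ≤ p.2 x) ∧ (∑ x, p.2 x) = 1 ∧ (∀ x, p.1 x ≤ f (p.2 x))} := by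
  have hκ1 : κ < 1 := by
    by_contra! h
    nlinarith
  have hα1 : 1 < α := by nlinarith
  obtain ⟨⟨hfc, hf0, -⟩, c, hc, hcf⟩ := hf
  obtain ⟨a, b, hab⟩ := Fintype.one_lt_card_iff.mp (by omega : 1 < Fintype.card X)
  have hf1 : 1 ≤ f 1 := by
    have hfc1 : Tendsto f (𝓝[<] 1) (𝓝 (f 1)) :=
      ((hfc 1 (by simp)).continuousAt (Ici_mem_nhds one_pos)).tendsto.mono_left
        nhdsWithin_le_nhds
    refine le_of_tendsto_of_tendsto (tendsto_id.mono_left nhdsWithin_le_nhds) hfc1 ?_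
    filter_upwards [Ioo_mem_nhdsLT (by linarith [hε.1] : 1 - ε < 1)] with x hx
    exact hfx x hx
  intro hcont
  have h0 := hcont (twoPoint a b 0, twoPoint a b 0) (by
    refine ⟨twoPoint_nonneg le_rfl zero_le_one, sum_twoPoint hab 0,
      twoPoint_nonneg le_rfl zero_le_one, sum_twoPoint hab 0, fun x => ?_⟩
    by_cases hxb : x = b
    · subst hxb
      simpa [twoPoint_right hab] using hf1
    · have : twoPoint a b 0 x = 0 := by simp [twoPoint, hxb]
      simpa [this] using hf0 0 (by simp))
  have hzero : Dcl α (twoPoint a b 0) (twoPoint a b 0) = ((0 : ℝ) : EReal) := by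
    have hα0 : α ≠ 0 := hα.ne'
    rw [Dcl_twoPoint hab hα1 (fun _ => rfl) one_pos (by simp [Real.zero_rpow hα0])]
    simp [Real.zero_rpow hα0]
  unfold ContinuousWithinAt at h0
  simp only [hzero] at h0
  have hid : Tendsto (fun t : ℝ => t) (𝓝[>] 0) (𝓝 0) := nhdsWithin_le_nhds
  have hs : Tendsto (fun t : ℝ => c * t ^ κ) (𝓝[>] 0) (𝓝 0) := by
    have := (Real.continuousAt_rpow_const 0 κ (Or.inr hκ.le)).tendsto.mono_left
      (nhdsWithin_le_nhds (s := Set.Ioi 0))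
    simpa [Real.zero_rpow hκ.ne'] using this.const_mul c
  have hts : ∀ᶠ t : ℝ in 𝓝[>] 0, t ≤ c * t ^ κ := by
    have h : Tendsto (fun t : ℝ => t ^ (1 - κ)) (𝓝[>] 0) (𝓝 0) := by
      have := (Real.continuousAt_rpow_const 0 (1 - κ) (Or.inr (by linarith))).tendsto.mono_left
        (nhdsWithin_le_nhds (s := Set.Ioi 0))
      simpa [Real.zero_rpow (by linarith : 1 - κ ≠ 0)] using this
    filter_upwards [h.eventually_lt_const hc, self_mem_nhdsWithin] with t ht ht0
    calc t = t ^ (1 - κ) * t ^ κ := by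
          rw [← Real.rpow_add ht0, sub_add_cancel, Real.rpow_one]
      _ ≤ c * t ^ κ := by
          have := Real.rpow_nonneg (le_of_lt ht0) κ
          gcongr
  have hpath : Tendsto (fun t : ℝ => (twoPoint a b (c * t ^ κ), twoPoint a b t)) (𝓝[>] 0)
      (𝓝[{p : (X → ℝ) × (X → ℝ) | (∀ x, 0 ≤ p.1 x) ∧ (∑ x, p.1 x) = 1 ∧
        (∀ x, 0 ≤ p.2 x) ∧ (∑ x, p.2 x) = 1 ∧ (∀ x, p.1 x ≤ f (p.2 x))}]
        (twoPoint a b 0, twoPoint a b 0)) := by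
    refine tendsto_nhdsWithin_iff.mpr
      ⟨((continuous_twoPoint.tendsto 0).comp hs).prodMk_nhds
        ((continuous_twoPoint.tendsto 0).comp hid), ?_⟩
    filter_upwards [hcf, hts, hs.eventually_lt_const one_pos, hid.eventually_lt_const hε.1,
      self_mem_nhdsWithin] with t hct htt hs1 htε ht0
    have ht0 : 0 < t := ht0
    have ht1 : t < 1 := htε.trans hε.2
    refine ⟨twoPoint_nonneg (ht0.le.trans htt) hs1.le, sum_twoPoint hab _,
      twoPoint_nonneg ht0.le ht1.le, sum_twoPoint hab _, fun x => ?_⟩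
    by_cases hxa : x = a
    · subst hxa
      simpa only [twoPoint_left] using hct
    by_cases hxb : x = b
    · subst hxb
      simp only [twoPoint_right hab]
      linarith [hfx (1 - t) ⟨by linarith, by linarith⟩]
    · simpa only [twoPoint_of_ne hxa hxb] using hf0 0 (by simp)
  have hlim := h0.comp hpath
  set r : ℝ → ℝ := fun t => (1 - c * t ^ κ) ^ α * (1 - t) ^ (1 - α) with hr_def
  have hr : Tendsto r (𝓝[>] 0) (𝓝 1) := by
    have hp := (hs.const_sub 1).rpow_const (p := α) (Or.inl (by norm_num))
    have hq := (hid.const_sub 1).rpow_const (p := 1 - α) (Or.inl (by norm_num))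
    simpa using hp.mul hq
  have hcα : 0 < c ^ α := Real.rpow_pos_of_pos hc α
  have hlower : ∀ᶠ t : ℝ in 𝓝[>] 0, c ^ α ≤ (c * t ^ κ) ^ α * t ^ (1 - α) := by
    filter_upwards [hid.eventually_lt_const one_pos, self_mem_nhdsWithin] with t ht1 ht0
    have ht0 : 0 < t := ht0
    rw [Real.mul_rpow hc.le (Real.rpow_nonneg ht0.le κ), ← Real.rpow_mul ht0.le, mul_assoc,
      ← Real.rpow_add ht0]
    exact le_mul_of_one_le_right hcα.le
      (Real.one_le_rpow_of_pos_of_le_one_of_nonpos ht0 ht1.le (by linarith))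
  have hreal : Tendsto (fun t : ℝ => (α - 1)⁻¹ *
      Real.log ((c * t ^ κ) ^ α * t ^ (1 - α) + r t)) (𝓝[>] 0) (𝓝 0) := by
    refine EReal.tendsto_coe.mp (hlim.congr' ?_)
    filter_upwards [hlower, hr.eventually_const_lt one_pos, hid.eventually_lt_const one_pos,
      self_mem_nhdsWithin] with t hl hrt ht1 ht0
    exact Dcl_twoPoint hab hα1 (fun h => absurd h (ne_of_gt ht0)) ht1
      (add_pos (hcα.trans_le hl) hrt)
  have hbound : Tendsto (fun t => (α - 1)⁻¹ * Real.log (c ^ α + r t)) (𝓝[>] 0)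
      (𝓝 ((α - 1)⁻¹ * Real.log (c ^ α + 1))) :=
    ((hr.const_add _).log (by positivity)).const_mul _
  have hα' : 0 < (α - 1)⁻¹ := inv_pos.mpr (by linarith)
  have hle : (α - 1)⁻¹ * Real.log (c ^ α + 1) ≤ 0 := by
    refine le_of_tendsto_of_tendsto hbound hreal ?_
    filter_upwards [hlower, hr.eventually_const_lt one_pos] with t hl hrt
    exact mul_le_mul_of_nonneg_left
      (Real.log_le_log (add_pos hcα hrt) (by linarith)) hα'.le
  exact hle.not_gt (mul_pos hα' (Real.log_pos (by linarith)))

end QRenyi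

end
end
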